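/- Let f : ℝ → ℝ be a smooth function whose support is a compact subset of the open interval (0, ∞). Then for every real p, ∫₀^∞ (f''(r) + f'(r)/r)·J₀(p·r)·r dr = −p²·∫₀^∞ f(r)·J₀(p·r)·r dr. -/

import Mathlib

open Real MeasureTheory intervalIntegral

noncomputable def besselJ0 (x : ℝ) : ℝ :=
  (1 / Real.pi) * ∫ θ in (0:ℝ)..Real.pi, Real.cos (x * Real.sin θ)

noncomputable def besselJ1 (x : ℝ) : ℝ :=
  (1 / Real.pi) * ∫ θ in (0:ℝ)..Real.pi, Real.cos (θ - x * Real.sin θ)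

noncomputable def struveH0 (x : ℝ) : ℝ :=
  (2 / Real.pi) * ∫ θ in (0:ℝ)..(Real.pi / 2), Real.sin (x * Real.cos θ)

noncomputable def struveH1 (x : ℝ) : ℝ :=
  (2 * x / Real.pi) * ∫ θ in (0:ℝ)..(Real.pi / 2),
    Real.sin (x * Real.cos θ) * (Real.sin θ) ^ 2

noncomputable def besselPhi (x : ℝ) : ℝ :=
  x * besselJ0 x +
    (Real.pi * x / 2) * (struveH0 x * besselJ1 x - struveH1 x * besselJ0 x)

noncomputable def haarPsi (t : ℝ) : ℝ :=
  if t ∈ Set.Ico (0 : ℝ) (1 / 2) then 1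
  else if t ∈ Set.Ico (1 / 2 : ℝ) 1 then -1
  else 0

noncomputable def haarPsiJK (j k : ℕ) (t : ℝ) : ℝ :=
  2 ^ ((j : ℝ) / 2) * haarPsi (2 ^ j * t - k)

noncomputable def errorFun (x : ℝ) : ℝ :=
  (2 / Real.sqrt Real.pi) * ∫ t in (0:ℝ)..x, Real.exp (-t ^ 2)

noncomputable def besselJ0Deriv (x : ℝ) : ℝ :=
  (1 / Real.pi) * ∫ θ in (0:ℝ)..Real.pi, -(Real.sin θ * Real.sin (x * Real.sin θ))

noncomputable def besselJ0SecondDeriv (x : ℝ) : ℝ :=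
  (1 / Real.pi) * ∫ θ in (0:ℝ)..Real.pi, -(Real.sin θ ^ 2 * Real.cos (x * Real.sin θ))

theorem hasDerivAt_intervalIntegral_of_continuous_of_norm_le {F F' : ℝ → ℝ → ℝ} {a b C : ℝ}
    (hF : ∀ x, Continuous (F x)) (hF' : ∀ x, Continuous (F' x))
    (hbound : ∀ x t, ‖F' x t‖ ≤ C) (hderiv : ∀ x t, HasDerivAt (fun y => F y t) (F' x t) x)
    (x : ℝ) :
    HasDerivAt (fun y => ∫ t in a..b, F y t) (∫ t in a..b, F' x t) x :=
  (intervalIntegral.hasDerivAt_integral_of_dominated_loc_of_deriv_le (bound := fun _ => C)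
    Filter.univ_mem (.of_forall fun y => (hF y).aestronglyMeasurable)
    ((hF x).intervalIntegrable _ _) (hF' x).aestronglyMeasurable
    (.of_forall fun t _ y _ => hbound y t) intervalIntegrable_const
    (.of_forall fun t _ y _ => hderiv y t)).2

theorem hasDerivAt_besselJ0 (x : ℝ) : HasDerivAt besselJ0 (besselJ0Deriv x) x := by
  refine HasDerivAt.const_mul (1 / Real.pi)
    (hasDerivAt_intervalIntegral_of_continuous_of_norm_le (C := 1)
      (F := fun x θ => Real.cos (x * Real.sin θ))
      (F' := fun x θ => -(Real.sin θ * Real.sin (x * Real.sin θ)))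
      (fun _ => by fun_prop) (fun _ => by fun_prop) (fun x t => ?_) (fun x t => ?_) x)
  · rw [norm_neg, norm_mul]
    exact mul_le_one₀ (Real.abs_sin_le_one _) (norm_nonneg _) (Real.abs_sin_le_one _)
  · refine ((hasDerivAt_id x).mul_const (Real.sin t)).cos.congr_deriv ?_
    simp only [id, one_mul]
    ring

theorem hasDerivAt_besselJ0Deriv (x : ℝ) :
    HasDerivAt besselJ0Deriv (besselJ0SecondDeriv x) x := by
  refine HasDerivAt.const_mul (1 / Real.pi)
    (hasDerivAt_intervalIntegral_of_continuous_of_norm_le (C := 1)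
      (F := fun x θ => -(Real.sin θ * Real.sin (x * Real.sin θ)))
      (F' := fun x θ => -(Real.sin θ ^ 2 * Real.cos (x * Real.sin θ)))
      (fun _ => by fun_prop) (fun _ => by fun_prop) (fun x t => ?_) (fun x t => ?_) x)
  · rw [norm_neg, norm_mul, norm_pow]
    exact mul_le_one₀ (pow_le_one₀ (norm_nonneg _) (Real.abs_sin_le_one _)) (norm_nonneg _)
      (Real.abs_cos_le_one _)
  · refine (((hasDerivAt_id x).mul_const (Real.sin t)).sin.const_mul
      (Real.sin t)).neg.congr_deriv ?_
    simp only [id, one_mul]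
    ring

theorem continuous_besselJ0 : Continuous besselJ0 :=
  continuous_iff_continuousAt.2 fun x => (hasDerivAt_besselJ0 x).continuousAt

/-- Bessel's differential equation of order `0`. -/
theorem besselJ0_ode (x : ℝ) :
    x * besselJ0SecondDeriv x + besselJ0Deriv x + x * besselJ0 x = 0 := by
  have h : ∫ θ in (0:ℝ)..Real.pi, (x * -(Real.sin θ ^ 2 * Real.cos (x * Real.sin θ))
      + -(Real.sin θ * Real.sin (x * Real.sin θ)) + x * Real.cos (x * Real.sin θ)) = 0 := by
    rw [intervalIntegral.integral_eq_sub_of_hasDerivAt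
      (f := fun θ => Real.cos θ * Real.sin (x * Real.sin θ))]
    · simp
    · intro θ _
      refine ((Real.hasDerivAt_cos θ).mul
        ((Real.hasDerivAt_sin θ).const_mul x).sin).congr_deriv ?_
      linear_combination (x * Real.cos (x * Real.sin θ)) * Real.sin_sq_add_cos_sq θ
    · exact Continuous.intervalIntegrable (by fun_prop) _ _
  rw [intervalIntegral.integral_add (Continuous.intervalIntegrable (by fun_prop) _ _)
      (Continuous.intervalIntegrable (by fun_prop) _ _),
    intervalIntegral.integral_add (Continuous.intervalIntegrable (by fun_prop) _ _)
      (Continuous.intervalIntegrable (by fun_prop) _ _),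
    intervalIntegral.integral_const_mul, intervalIntegral.integral_const_mul] at h
  rw [besselJ0, besselJ0Deriv, besselJ0SecondDeriv]
  linear_combination (1 / Real.pi) * h

theorem hankel0_laplacian (f : ℝ → ℝ) (hf : ContDiff ℝ (⊤ : ℕ∞) f)
    (hcompact : IsCompact (tsupport f)) (hsupp : tsupport f ⊆ Set.Ioi (0 : ℝ))
    (p : ℝ) :
    ∫ r in Set.Ioi (0 : ℝ),
        (deriv (deriv f) r + deriv f r / r) * besselJ0 (p * r) * r
      = -p ^ 2 * ∫ r in Set.Ioi (0 : ℝ), f r * besselJ0 (p * r) * r := by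
  have hf1 : ContDiff ℝ (⊤ : ℕ∞) (deriv f) := (contDiff_infty_iff_deriv.1 hf).2
  have hf2 : ContDiff ℝ (⊤ : ℕ∞) (deriv (deriv f)) := (contDiff_infty_iff_deriv.1 hf1).2
  have hc : HasCompactSupport f := hcompact
  have hc1 : HasCompactSupport (deriv f) := hc.deriv
  have hc2 : HasCompactSupport (deriv (deriv f)) := hc1.deriv
  have cf := hf.continuous
  have cf1 := hf1.continuous
  have cf2 := hf2.continuous
  have cJ : Continuous fun r => besselJ0 (p * r) := continuous_besselJ0.comp (by fun_prop)
  have hJ (r : ℝ) : HasDerivAt (fun r => besselJ0 (p * r)) (besselJ0Deriv (p * r) * p) r := by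
    exact (hasDerivAt_besselJ0 (p * r)).comp r (hasDerivAt_const_mul p)
  have hJ' (r : ℝ) : HasDerivAt (fun r => besselJ0Deriv (p * r))
      (besselJ0SecondDeriv (p * r) * p) r := by
    exact (hasDerivAt_besselJ0Deriv (p * r)).comp r (hasDerivAt_const_mul p)
  have hD (r : ℝ) : HasDerivAt
      (fun r => deriv f r * (r * besselJ0 (p * r)) - f r * (r * (besselJ0Deriv (p * r) * p)))
      ((deriv (deriv f) r * r + deriv f r) * besselJ0 (p * r)
        + p ^ 2 * (f r * besselJ0 (p * r) * r)) r := by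
    have d0 : HasDerivAt f (deriv f r) r := (hf.differentiable (by simp) r).hasDerivAt
    have d1 : HasDerivAt (deriv f) (deriv (deriv f) r) r :=
      (hf1.differentiable (by simp) r).hasDerivAt
    refine ((d1.mul ((hasDerivAt_id r).mul (hJ r))).sub
      (d0.mul ((hasDerivAt_id r).mul ((hJ' r).mul_const p)))).congr_deriv ?_
    simp only [Pi.mul_apply, id, one_mul]
    linear_combination -p * f r * besselJ0_ode (p * r)
  have i1 : Integrable fun r => (deriv (deriv f) r * r + deriv f r) * besselJ0 (p * r) :=
    Continuous.integrable_of_hasCompactSupport (by fun_prop) ((hc2.mul_right.add hc1).mul_right)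
  have i2 : Integrable fun r => f r * besselJ0 (p * r) * r :=
    Continuous.integrable_of_hasCompactSupport (by fun_prop) hc.mul_right.mul_right
  have hG : HasCompactSupport fun r =>
      deriv f r * (r * besselJ0 (p * r)) - f r * (r * (besselJ0Deriv (p * r) * p)) :=
    hc1.mul_right.sub hc.mul_right
  have key := integral_Ioi_of_hasDerivAt_of_tendsto' (a := 0) (fun r _ => hD r)
    (i1.add (i2.const_mul (p ^ 2))).integrableOn
    (hG.is_zero_at_infty.mono_left atTop_le_cocompact)
  rw [integral_add i1.integrableOn (i2.const_mul (p ^ 2)).integrableOn,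
    MeasureTheory.integral_const_mul] at key
  have hcongr : ∫ r in Set.Ioi (0 : ℝ),
      (deriv (deriv f) r + deriv f r / r) * besselJ0 (p * r) * r
      = ∫ r in Set.Ioi (0 : ℝ), (deriv (deriv f) r * r + deriv f r) * besselJ0 (p * r) :=
    setIntegral_congr_fun measurableSet_Ioi fun r hr => by
      have : r ≠ 0 := (Set.mem_Ioi.1 hr).ne'
      field_simp
  rw [hcongr]
  simp only [zero_mul, mul_zero, sub_zero] at key
  linear_combination key
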